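/- arXiv:2602.10337 — 9 statements merged into one kernel-verified Lean document; each statement's English description precedes it below -/
import Mathlib

section
/- Let n be an even positive integer and k ≥ 1 an integer. Let m ≥ 0 be an integer, let σ : Fin m → ZMod n be a sequence of ring-edge requests (request t is the node pair (σ t, σ t + 1)), and let opt : Fin (m+1) → (ZMod n → Bool) be any schedule of colorings in which every coloring opt t has exactly n/2 nodes colored true (opt 0 is the initial coloring and opt (t+1) is the coloring after serving request t). Then there exists a schedule off : Fin (m+1) → (ZMod n → Bool) such that: (i) |CE(off t)| ≤ 2k for every t; (ii) every off t is (3/2 + 1/k)-balanced, i.e., 4·k·|{i | off t i = b}| ≤ (3k + 2)·n for each color b ∈ {true, false}; and (iii) d_H(opt 0, off 0) + Σ_{t=0}^{m−1} ( hit(off t, σ t) + d_H(off t, off (t+1)) ) ≤ (3k + 1) · Σ_{t=0}^{m−1} ( hit(opt t, σ t) + d_H(opt t, opt (t+1)) ) + 2n, where hit(c, e) := 1 if c e ≠ c (e+1) and hit(c, e) := 0 otherwise. -/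
/-- The cut-edge set of a coloring `c` of the ring `ZMod n`:
edges `i` (joining node `i` to node `i+1`) whose endpoints get different colors. -/
def CE {n : ℕ} (c : ZMod n → Bool) : Set (ZMod n) := {i | c i ≠ c (i + 1)}

/-- Hamming distance between two colorings of `ZMod n`. -/
noncomputable def hamDist {n : ℕ} (c c' : ZMod n → Bool) : ℕ :=
  {i : ZMod n | c i ≠ c' i}.ncard

/-- The hit cost of serving the ring-edge request `(e, e+1)` under coloring `c`. -/
def hit {n : ℕ} (c : ZMod n → Bool) (e : ZMod n) : ℕ :=
  if c e ≠ c (e + 1) then 1 else 0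

/-- The number of nodes that `c` colors `b` and `o` does not. -/
noncomputable def excess {n : ℕ} (c o : ZMod n → Bool) (b : Bool) : ℕ :=
  {i : ZMod n | c i = b ∧ o i ≠ b}.ncard

section Ring

variable {n : ℕ} [NeZero n]

omit [NeZero n] in
lemma hamDist_comm (c c' : ZMod n → Bool) : hamDist c c' = hamDist c' c := by
  simp only [hamDist, ne_comm]

lemma hamDist_triangle (a b c : ZMod n → Bool) :
    hamDist a c ≤ hamDist a b + hamDist b c := by
  refine (Set.ncard_le_ncard ?_ (Set.toFinite _)).trans (Set.ncard_union_le _ _)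
  intro i hi
  by_cases h : a i = b i
  · exact Or.inr (by simpa [h] using hi)
  · exact Or.inl h

lemma hamDist_add_of_between {c c' o : ZMod n → Bool}
    (h : ∀ i, c' i = c i ∨ c' i = o i) :
    hamDist c c' + hamDist c' o = hamDist c o := by
  unfold hamDist
  rw [← Set.ncard_union_eq ?_ (Set.toFinite _) (Set.toFinite _)]
  · congr 1
    ext i
    have := h i
    simp only [Set.mem_union, Set.mem_ofPred_eq]
    grind
  · rw [Set.disjoint_left]
    intro i h1 h2
    have := h i
    simp only [Set.mem_ofPred_eq] at h1 h2
    grind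

lemma excess_mono {c c' o : ZMod n → Bool} (h : ∀ i, c' i = c i ∨ c' i = o i) (b : Bool) :
    excess c' o b ≤ excess c o b := by
  refine Set.ncard_le_ncard ?_ (Set.toFinite _)
  intro i hi
  have := h i
  simp only [Set.mem_ofPred_eq] at hi ⊢
  grind

lemma excess_le_add_hamDist (c o o' : ZMod n → Bool) (b : Bool) :
    excess c o' b ≤ excess c o b + hamDist o o' := by
  refine (Set.ncard_le_ncard ?_ (Set.toFinite _)).trans (Set.ncard_union_le _ _)
  intro i hi
  simp only [Set.mem_ofPred_eq, Set.mem_union] at hi ⊢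
  grind

lemma ncard_color_le (c o : ZMod n → Bool) (b : Bool) :
    {i | c i = b}.ncard ≤ {i | o i = b}.ncard + excess c o b := by
  refine (Set.ncard_le_ncard ?_ (Set.toFinite _)).trans (Set.ncard_union_le _ _)
  intro i hi
  simp only [Set.mem_ofPred_eq, Set.mem_union] at hi ⊢
  tauto

lemma ncard_color_not (c : ZMod n → Bool) (b : Bool) :
    {i | c i = b}.ncard + {i | c i = !b}.ncard = n := by
  have h : {i | c i = !b} = {i | c i = b}ᶜ := by
    ext i
    simp only [Set.mem_ofPred_eq, Set.mem_compl_iff]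
    cases c i <;> cases b <;> simp
  rw [h, Set.ncard_add_ncard_compl, Nat.card_zmod]

lemma hamDist_add_hamDist_not (c o : ZMod n → Bool) :
    hamDist c o + hamDist (fun i => !c i) o = n := by
  have h : {i | (!c i) ≠ o i} = {i | c i ≠ o i}ᶜ := by
    ext i
    simp only [Set.mem_ofPred_eq, Set.mem_compl_iff]
    cases c i <;> cases o i <;> simp
  rw [hamDist, hamDist, h, Set.ncard_add_ncard_compl, Nat.card_zmod]

/-- Two colorings with equally many nodes of color `b` differ on equally many nodes of each kind. -/
lemma two_mul_excess {c o : ZMod n → Bool} {b : Bool}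
    (h : {i | c i = b}.ncard = {i | o i = b}.ncard) :
    2 * excess c o b = hamDist c o := by
  have h1 := Set.ncard_inter_add_ncard_sdiff_eq_ncard {i | c i = b} {i | o i = b}
    (Set.toFinite _)
  have h2 := Set.ncard_inter_add_ncard_sdiff_eq_ncard {i | o i = b} {i | c i = b}
    (Set.toFinite _)
  rw [Set.inter_comm] at h2
  have h3 : hamDist c o
      = ({i | c i = b} \ {i | o i = b}).ncard + ({i | o i = b} \ {i | c i = b}).ncard := by
    rw [hamDist, ← Set.ncard_union_eq ?_ (Set.toFinite _) (Set.toFinite _)]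
    · congr 1
      ext i
      simp only [Set.mem_union, Set.mem_ofPred_eq, Set.mem_sdiff]
      cases c i <;> cases o i <;> cases b <;> simp
    · exact disjoint_sdiff_sdiff
  have h4 : excess c o b = ({i | c i = b} \ {i | o i = b}).ncard := rfl
  omega

/-- Recoloring an endpoint of a cut edge does not increase the number of cut edges. -/
lemma ncard_CE_update_le {c : ZMod n → Bool} {x y : ZMod n} (hx : x ∈ CE c)
    (hy : y = x ∨ y = x + 1) :
    (CE (Function.update c y (!c y))).ncard ≤ (CE c).ncard := by
  have key : ∀ z, CE (Function.update c y (!c y)) ⊆ insert z (CE c \ {x}) →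
      (CE (Function.update c y (!c y))).ncard ≤ (CE c).ncard := fun z hz =>
    ((Set.ncard_le_ncard hz (Set.toFinite _)).trans (Set.ncard_insert_le _ _)).trans_eq
      (Set.ncard_sdiff_singleton_add_one hx (Set.toFinite _))
  have hx' : c x ≠ c (x + 1) := hx
  have hne : x ≠ x + 1 := fun h => hx' (by rw [← h])
  rcases hy with rfl | rfl
  · apply key (y - 1)
    intro z hz
    simp only [CE, Set.mem_insert_iff, Set.mem_sdiff, Set.mem_ofPred_eq, Set.mem_singleton_iff,
      Function.update_apply] at hz ⊢
    have : z + 1 = y → z = y - 1 := fun h => eq_sub_of_add_eq h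
    have hb : (!c y) = c (y + 1) := Bool.not_eq.mpr hx'
    grind
  · apply key (x + 1)
    intro z hz
    simp only [CE, Set.mem_insert_iff, Set.mem_sdiff, Set.mem_ofPred_eq, Set.mem_singleton_iff,
      Function.update_apply] at hz ⊢
    have : z + 1 = x + 1 → z = x := fun h => add_right_cancel h
    have hb : c x = !c (x + 1) := Bool.eq_not.mpr hx'
    grind

/-- Any coloring `c` can be moved towards `o` until all its cut edges are cut edges of `o`,
without increasing the number of cut edges. -/
lemma exists_between_CE_subset (o c : ZMod n → Bool) :
    ∃ c' : ZMod n → Bool, (∀ i, c' i = c i ∨ c' i = o i) ∧ CE c' ⊆ CE o ∧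
      (CE c').ncard ≤ (CE c).ncard := by
  induction hd : hamDist c o using Nat.strong_induction_on generalizing c with
  | _ d ih =>
    by_cases hsub : CE c ⊆ CE o
    · exact ⟨c, fun _ => Or.inl rfl, hsub, le_rfl⟩
    · obtain ⟨x, hx, hxo⟩ := Set.not_subset.mp hsub
      obtain ⟨y, hy, hyo⟩ : ∃ y, (y = x ∨ y = x + 1) ∧ c y ≠ o y := by
        by_contra! h
        have h1 := h x (Or.inl rfl)
        have h2 := h (x + 1) (Or.inr rfl)
        simp only [CE, Set.mem_ofPred_eq] at hx hxo
        grind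
      have hbet : ∀ i, Function.update c y (!c y) i = c i ∨
          Function.update c y (!c y) i = o i := by
        intro i
        by_cases hi : i = y
        · subst hi
          exact Or.inr (by simpa [Bool.eq_not] using hyo)
        · exact Or.inl (Function.update_of_ne hi _ _)
      have hlt : hamDist (Function.update c y (!c y)) o < d := by
        rw [← hd, ← hamDist_add_of_between hbet]
        have : 0 < hamDist c (Function.update c y (!c y)) :=
          (Set.ncard_pos (Set.toFinite _)).mpr ⟨y, by simp⟩
        omega
      obtain ⟨c', hc', hsub', hcard⟩ := ih _ hlt _ rfl
      refine ⟨c', fun i => ?_, hsub', hcard.trans (ncard_CE_update_le hx hy)⟩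
      have h1 := hc' i
      have h2 := hbet i
      grind

omit [NeZero n] in
lemma CE_not (c : ZMod n → Bool) : CE (fun i => !c i) = CE c := by
  ext i
  simp [CE]

/-- There is a coloring with `h` nodes colored `true` and at most two cut edges. -/
lemma exists_arc {h : ℕ} (hh : h ≤ n) :
    ∃ c : ZMod n → Bool, {i | c i = true}.ncard = h ∧ (CE c).ncard ≤ 2 := by
  refine ⟨fun i => decide (i.val < h), ?_, ?_⟩
  · have himg : {i : ZMod n | decide (i.val < h) = true}
        = (fun j : ℕ => (j : ZMod n)) '' (Finset.range h : Set ℕ) := by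
      ext i
      simp only [decide_eq_true_eq, Set.mem_ofPred_eq, Set.mem_image, Finset.coe_range,
        Set.mem_Iio]
      constructor
      · exact fun hi => ⟨i.val, hi, ZMod.natCast_zmod_val i⟩
      · rintro ⟨j, hj, rfl⟩
        rwa [ZMod.val_natCast_of_lt (hj.trans_le hh)]
    rw [himg, Set.InjOn.ncard_image, Set.ncard_coe_finset, Finset.card_range]
    intro a ha b hb hab
    simp only [Finset.coe_range, Set.mem_Iio] at ha hb
    have := congrArg ZMod.val hab
    simpa [ZMod.val_natCast_of_lt (ha.trans_le hh), ZMod.val_natCast_of_lt (hb.trans_le hh)]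
      using this
  · refine (Set.ncard_le_ncard (t := {((h - 1 : ℕ) : ZMod n), ((n - 1 : ℕ) : ZMod n)}) ?_
      (Set.toFinite _)).trans
        ((Set.ncard_insert_le _ _).trans_eq (by rw [Set.ncard_singleton]))
    intro x hx
    simp only [CE, Set.mem_ofPred_eq, ne_eq, decide_eq_decide] at hx
    have hxn := ZMod.val_lt x
    have hcast := ZMod.natCast_zmod_val x
    by_cases hlast : x.val + 1 < n
    · have hsucc : (x + 1).val = x.val + 1 := by
        conv_lhs => rw [← hcast]
        rw [← Nat.cast_add_one, ZMod.val_natCast_of_lt hlast]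
      left
      rw [← hcast]
      congr 1
      omega
    · right
      rw [Set.mem_singleton_iff, ← hcast]
      congr 1
      omega

/-- A fresh coloring, at distance at most `n / 2` from the balanced coloring `o`. -/
lemma exists_restart (hne : Even n) {o : ZMod n → Bool} (ho : {i | o i = true}.ncard = n / 2) :
    ∃ c : ZMod n → Bool, CE c ⊆ CE o ∧ (CE c).ncard ≤ 2 ∧ 2 * hamDist c o ≤ n ∧
      ∀ b, 4 * excess c o b ≤ n := by
  have ho' : ∀ b, {i | o i = b}.ncard = n / 2 := by
    have := ncard_color_not o true
    obtain ⟨r, hr⟩ := hne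
    rintro (_ | _)
    · simp only [Bool.not_true] at this
      omega
    · exact ho
  obtain ⟨c, hc, hcut, hd⟩ : ∃ c : ZMod n → Bool, (∀ b, {i | c i = b}.ncard = n / 2) ∧
      (CE c).ncard ≤ 2 ∧ 2 * hamDist c o ≤ n := by
    obtain ⟨c, hc, hcut⟩ := exists_arc (n := n) (Nat.div_le_self n 2)
    have hc' : {i | c i = false}.ncard = n / 2 := by
      have := ncard_color_not c true
      obtain ⟨r, hr⟩ := hne
      simp only [Bool.not_true] at this
      omega
    have hsum := hamDist_add_hamDist_not c o
    by_cases hd : 2 * hamDist c o ≤ n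
    · refine ⟨c, ?_, hcut, hd⟩
      rintro (_ | _) <;> assumption
    · refine ⟨fun i => !c i, ?_, by rwa [CE_not], by omega⟩
      rintro (_ | _) <;> simpa
  obtain ⟨c', hbet, hsub, hcard⟩ := exists_between_CE_subset o c
  have hadd := hamDist_add_of_between hbet
  refine ⟨c', hsub, hcard.trans hcut, by omega, fun b => ?_⟩
  have h1 := excess_mono hbet b
  have h2 := two_mul_excess ((hc b).trans (ho' b).symm)
  omega

/-- The invariant of the offline algorithm: `c` is its current coloring, `o` is the optimal one,
and `M` is the distance the optimal schedule has moved since the last restart. -/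
structure Tracks (k M : ℕ) (o c : ZMod n → Bool) : Prop where
  CE_subset : CE c ⊆ CE o
  ncard_CE : (CE c).ncard ≤ 2
  excess_le : ∀ b, 4 * excess c o b ≤ n + 4 * M
  move_lt : 3 * k * M < n

omit [NeZero n] in
lemma Tracks.hit_le {k M : ℕ} {o c : ZMod n → Bool} (h : Tracks k M o c) (e : ZMod n) :
    hit c e ≤ hit o e := by
  by_cases he : e ∈ CE c
  · have := h.CE_subset he
    simp only [CE, Set.mem_ofPred_eq] at he this
    simp [hit, he, this]
  · simp only [CE, Set.mem_ofPred_eq] at he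
    simp [hit, he]

lemma Tracks.balanced {k M : ℕ} {o c : ZMod n → Bool} (h : Tracks k M o c) (hne : Even n)
    (ho : {i | o i = true}.ncard = n / 2) (b : Bool) :
    4 * k * {i | c i = b}.ncard ≤ (3 * k + 2) * n := by
  have h1 := ncard_color_le c o b
  have h2 := h.excess_le b
  have h3 := h.move_lt
  have h4 : 2 * {i | o i = b}.ncard = n := by
    have := ncard_color_not o true
    obtain ⟨r, hr⟩ := hne
    simp only [Bool.not_true] at this
    cases b <;> omega
  have h5 : 4 * {i | c i = b}.ncard ≤ 3 * n + 4 * M := by omega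
  nlinarith [Nat.mul_le_mul_left k h5]

lemma Tracks.exists_step {k M : ℕ} {o c : ZMod n → Bool} (h : Tracks k M o c) (hne : Even n)
    {o' : ZMod n → Bool} (ho' : {i | o' i = true}.ncard = n / 2) :
    ∃ (c' : ZMod n → Bool) (M' : ℕ), Tracks k M' o' c' ∧
      hamDist c c' + hamDist c' o' + 3 * k * M'
        ≤ hamDist c o + 3 * k * M + (3 * k + 1) * hamDist o o' := by
  have htri := hamDist_triangle c o o'
  by_cases hM : 3 * k * (M + hamDist o o') < n
  · obtain ⟨c', hbet, hsub, hcard⟩ := exists_between_CE_subset o' c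
    have hadd := hamDist_add_of_between hbet
    refine ⟨c', M + hamDist o o', ⟨hsub, hcard.trans h.ncard_CE, fun b => ?_, hM⟩, ?_⟩
    · have h1 := excess_mono hbet b
      have h2 := excess_le_add_hamDist c o o' b
      have h3 := h.excess_le b
      omega
    · nlinarith
  · obtain ⟨c', hsub, hcard, hd, hex⟩ := exists_restart hne ho'
    refine ⟨c', 0, ⟨hsub, hcard, fun b => by simpa using hex b, ?_⟩, ?_⟩
    · simpa using NeZero.pos n
    · have h1 := hamDist_triangle c o' c'
      rw [hamDist_comm o' c'] at h1
      nlinarith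

end Ring

theorem offline_algorithm (n k m : ℕ) (hn : 0 < n) (hne : Even n) (hk : 1 ≤ k)
    (σ : Fin m → ZMod n)
    (opt : Fin (m + 1) → ZMod n → Bool)
    (hopt : ∀ t, {i : ZMod n | opt t i = true}.ncard = n / 2) :
    ∃ off : Fin (m + 1) → ZMod n → Bool,
      (∀ t, (CE (off t)).ncard ≤ 2 * k) ∧
      (∀ t, ∀ b : Bool, 4 * k * {i : ZMod n | off t i = b}.ncard ≤ (3 * k + 2) * n) ∧
      hamDist (opt 0) (off 0) +
        ∑ t : Fin m, (hit (off t.castSucc) (σ t) + hamDist (off t.castSucc) (off t.succ))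
      ≤ (3 * k + 1) *
        ∑ t : Fin m, (hit (opt t.castSucc) (σ t) + hamDist (opt t.castSucc) (opt t.succ))
        + 2 * n := by
  have : NeZero n := ⟨hn.ne'⟩
  obtain ⟨c₀, hsub₀, hcard₀, hd₀, hex₀⟩ := exists_restart hne (hopt 0)
  have htracks₀ : Tracks k 0 (opt 0) c₀ :=
    ⟨hsub₀, hcard₀, fun b => by simpa using hex₀ b, by simpa using hn⟩
  have hstep : ∀ (t : Fin m) (s : (ZMod n → Bool) × ℕ), ∃ s' : (ZMod n → Bool) × ℕ,
      Tracks k s.2 (opt t.castSucc) s.1 → Tracks k s'.2 (opt t.succ) s'.1 ∧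
        hamDist s.1 s'.1 + hamDist s'.1 (opt t.succ) + 3 * k * s'.2
          ≤ hamDist s.1 (opt t.castSucc) + 3 * k * s.2
            + (3 * k + 1) * hamDist (opt t.castSucc) (opt t.succ) := by
    intro t s
    by_cases hs : Tracks k s.2 (opt t.castSucc) s.1
    · obtain ⟨c', M', h⟩ := hs.exists_step hne (hopt t.succ)
      exact ⟨(c', M'), fun _ => h⟩
    · exact ⟨s, fun h => absurd h hs⟩
  choose step hstep using hstep
  let s : Fin (m + 1) → (ZMod n → Bool) × ℕ :=
    fun t => Fin.induction (motive := fun _ => (ZMod n → Bool) × ℕ) (c₀, 0) step t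
  have hs0 : s 0 = (c₀, 0) := rfl
  have hss : ∀ t : Fin m, s t.succ = step t (s t.castSucc) := fun t => Fin.induction_succ ..
  have htr : ∀ t, Tracks k (s t).2 (opt t) (s t).1 := by
    intro t
    induction t using Fin.induction with
    | zero => exact htracks₀
    | succ t ih => rw [hss]; exact (hstep t _ ih).1
  obtain ⟨Φ, hΦ⟩ : ∃ Φ : Fin (m + 1) → ℕ,
      ∀ t, Φ t = hamDist (s t).1 (opt t) + 3 * k * (s t).2 := ⟨_, fun _ => rfl⟩
  have hcost : ∀ t : Fin m, hamDist (s t.castSucc).1 (s t.succ).1 + Φ t.succ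
      ≤ Φ t.castSucc + (3 * k + 1) * hamDist (opt t.castSucc) (opt t.succ) := by
    intro t
    have := (hstep t _ (htr t.castSucc)).2
    rw [← hss] at this
    rw [hΦ, hΦ]
    omega
  refine ⟨fun t => (s t).1, fun t => (htr t).ncard_CE.trans (by omega),
    fun t b => (htr t).balanced hne (hopt t) b, ?_⟩
  have hhit : ∑ t : Fin m, hit (s t.castSucc).1 (σ t) ≤ ∑ t : Fin m, hit (opt t.castSucc) (σ t) :=
    Finset.sum_le_sum fun t _ => (htr t.castSucc).hit_le (σ t)
  have hsum := Finset.sum_le_sum fun t (_ : t ∈ Finset.univ) => hcost t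
  have htel := (Fin.sum_univ_succ Φ).symm.trans (Fin.sum_univ_castSucc Φ)
  have hΦ0 : Φ 0 = hamDist c₀ (opt 0) := by simp [hΦ, hs0]
  rw [Finset.sum_add_distrib, Finset.sum_add_distrib, ← Finset.mul_sum] at hsum
  rw [Finset.sum_add_distrib, Finset.sum_add_distrib, hamDist_comm, mul_add]
  simp only [hs0]
  have hnonneg := Nat.zero_le (3 * k * ∑ t : Fin m, hit (opt t.castSucc) (σ t))
  linarith
end

section
/- Let n be an even positive integer and k ≥ 1 an integer. For every coloring c : ZMod n → Bool with exactly n/2 nodes colored true, there exists a coloring c' : ZMod n → Bool such that CE(c') ⊆ CE(c), |CE(c')| = min(2k, |CE(c)|), and c' is (1 + 1/k)-balanced, i.e., 2·k·less(c') ≥ (k − 1)·n. -/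
/-- The number of nodes of the less frequent color. -/
noncomputable def lessCount {n : ℕ} (c : ZMod n → Bool) : ℕ :=
  min {i : ZMod n | c i = true}.ncard {i : ZMod n | c i = false}.ncard

/-- The nodes of color `b`. -/
def colorClass {n : ℕ} [NeZero n] (c : ZMod n → Bool) (b : Bool) : Finset (ZMod n) :=
  {x | c x = b}

/-- The cut edges entering a block of color `b`. -/
def blockStarts {n : ℕ} [NeZero n] (c : ZMod n → Bool) (b : Bool) : Finset (ZMod n) :=
  {x | c x ≠ b ∧ c (x + 1) = b}

open Classical in
/-- The maximal run of color `b` beginning right after node `s`. -/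
noncomputable def block {n : ℕ} [NeZero n] (c : ZMod n → Bool) (b : Bool) (s : ZMod n) :
    Finset (ZMod n) :=
  {x | ∃ j : ℕ, x = s + 1 + j ∧ ∀ i ≤ j, c (s + 1 + (i : ZMod n)) = b}

/-- Recolor the block of color `b` beginning right after `s` with the opposite color. -/
noncomputable def flipBlock {n : ℕ} [NeZero n] (c : ZMod n → Bool) (b : Bool) (s : ZMod n) :
    ZMod n → Bool :=
  fun x => if x ∈ block c b s then !b else c x

section Ring

variable {n : ℕ} [NeZero n] {c : ZMod n → Bool} {b : Bool} {s t x : ZMod n}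

theorem mem_colorClass : x ∈ colorClass c b ↔ c x = b := by simp [colorClass]

theorem mem_blockStarts : x ∈ blockStarts c b ↔ c x ≠ b ∧ c (x + 1) = b := by
  simp [blockStarts]

theorem mem_block :
    x ∈ block c b s ↔ ∃ j : ℕ, x = s + 1 + j ∧ ∀ i ≤ j, c (s + 1 + (i : ZMod n)) = b := by
  simp [block]

theorem color_of_mem_block (h : x ∈ block c b s) : c x = b := by
  obtain ⟨j, rfl, hj⟩ := mem_block.1 h
  exact hj j le_rfl

theorem block_subset_colorClass : block c b s ⊆ colorClass c b :=
  fun _ h => mem_colorClass.2 (color_of_mem_block h)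

theorem succ_mem_block (h : x ∈ block c b s) (hx : c (x + 1) = b) : x + 1 ∈ block c b s := by
  obtain ⟨j, rfl, hj⟩ := mem_block.1 h
  refine mem_block.2 ⟨j + 1, by push_cast; ring, fun i hi => ?_⟩
  rcases Nat.le_succ_iff.1 hi with hi | rfl
  · exact hj i hi
  · rw [← hx]
    congr 1
    push_cast
    ring

theorem eq_or_mem_block_of_succ_mem (h : x + 1 ∈ block c b s) : x = s ∨ x ∈ block c b s := by
  obtain ⟨j, hx, hj⟩ := mem_block.1 h
  rcases j with _ | j
  · left
    simpa using hx
  · right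
    refine mem_block.2 ⟨j, ?_, fun i hi => hj i (by omega)⟩
    push_cast at hx
    linear_combination hx

theorem start_succ_mem_block (hs : s ∈ blockStarts c b) : s + 1 ∈ block c b s := by
  refine mem_block.2 ⟨0, by simp, fun i hi => ?_⟩
  obtain rfl : i = 0 := by omega
  simpa using (mem_blockStarts.1 hs).2

theorem eq_of_mem_block_of_mem_block (hs : s ∈ blockStarts c b) (ht : t ∈ blockStarts c b)
    (hxs : x ∈ block c b s) (hxt : x ∈ block c b t) : s = t := by
  obtain ⟨i, rfl, hi⟩ := mem_block.1 hxs
  obtain ⟨j, hx, hj⟩ := mem_block.1 hxt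
  rcases lt_trichotomy i j with hij | rfl | hij
  · obtain ⟨d, rfl⟩ := Nat.exists_eq_add_of_lt hij
    refine absurd ?_ (mem_blockStarts.1 hs).1
    rw [← hj d (by omega)]
    congr 1
    push_cast at hx
    linear_combination hx
  · linear_combination hx
  · obtain ⟨d, rfl⟩ := Nat.exists_eq_add_of_lt hij
    refine absurd ?_ (mem_blockStarts.1 ht).1
    rw [← hi d (by omega)]
    congr 1
    push_cast at hx
    linear_combination -hx

theorem exists_small_block (h : (blockStarts c b).Nonempty) :
    ∃ s ∈ blockStarts c b,
      (blockStarts c b).card * (block c b s).card ≤ (colorClass c b).card := by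
  classical
  have hsum : ∑ s ∈ blockStarts c b, (block c b s).card ≤ (colorClass c b).card := by
    rw [← Finset.card_biUnion fun s hs t ht hst => Finset.disjoint_left.2 fun x hxs hxt =>
      hst (eq_of_mem_block_of_mem_block hs ht hxs hxt)]
    exact Finset.card_le_card (Finset.biUnion_subset.2 fun _ _ => block_subset_colorClass)
  obtain ⟨s, hs, hmin⟩ := Finset.exists_min_image _ (fun s => (block c b s).card) h
  refine ⟨s, hs, le_trans ?_ hsum⟩
  simpa using Finset.card_nsmul_le_sum _ _ _ hmin

theorem blockStarts_flipBlock (hs : s ∈ blockStarts c b) :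
    blockStarts (flipBlock c b s) b = (blockStarts c b).erase s := by
  ext x
  have hsucc := succ_mem_block (c := c) (b := b) (s := s) (x := x)
  have hpred := eq_or_mem_block_of_succ_mem (c := c) (b := b) (s := s) (x := x)
  have hstart := start_succ_mem_block hs
  have hcol := color_of_mem_block (c := c) (b := b) (s := s) (x := x)
  have hb : (!b) ≠ b := by simp
  simp only [Finset.mem_erase, mem_blockStarts, flipBlock]
  by_cases hx : x ∈ block c b s <;> by_cases hx' : x + 1 ∈ block c b s <;> grind

theorem CE_flipBlock_subset (hs : s ∈ blockStarts c b) : CE (flipBlock c b s) ⊆ CE c := by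
  intro x hx
  have hpred := eq_or_mem_block_of_succ_mem (c := c) (b := b) (s := s) (x := x)
  have hsucc := succ_mem_block (c := c) (b := b) (s := s) (x := x)
  have hcol := color_of_mem_block (c := c) (b := b) (s := s) (x := x)
  have hstart := mem_blockStarts.1 hs
  simp only [CE, Set.mem_ofPred_eq, flipBlock] at hx ⊢
  by_cases h : x ∈ block c b s <;> by_cases h' : x + 1 ∈ block c b s <;> grind

theorem card_colorClass_flipBlock :
    (colorClass (flipBlock c b s) b).card + (block c b s).card = (colorClass c b).card := by
  have : colorClass (flipBlock c b s) b = colorClass c b \ block c b s := by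
    ext x
    by_cases hx : x ∈ block c b s <;> simp [mem_colorClass, flipBlock, hx]
  rw [this, Finset.card_sdiff_add_card_eq_card block_subset_colorClass]

theorem card_colorClass_add_not (c : ZMod n → Bool) (b : Bool) :
    (colorClass c b).card + (colorClass c !b).card = n := by
  have : colorClass c (!b) = (colorClass c b)ᶜ := by
    ext x
    simp [mem_colorClass, Bool.eq_not]
  rw [this, Finset.card_add_card_compl, ZMod.card]

theorem ncard_CE (c : ZMod n → Bool) (b : Bool) : (CE c).ncard = 2 * (blockStarts c b).card := by
  classical
  let T : Finset (ZMod n) := colorClass c b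
  let U : Finset (ZMod n) := colorClass (fun x => c (x + 1)) b
  have hcard : U.card = T.card :=
    Finset.card_bij' (fun x _ => x + 1) (fun x _ => x - 1)
      (by simp [T, U, mem_colorClass]) (by simp [T, U, mem_colorClass])
      (by simp) (by simp)
  have hstarts : blockStarts c b = U \ T := by
    ext x
    simp [T, U, mem_colorClass, mem_blockStarts, and_comm]
  have hCE : CE c = ((U \ T ∪ T \ U : Finset (ZMod n)) : Set (ZMod n)) := by
    ext x
    simp only [CE, Set.mem_ofPred_eq, Finset.coe_union, Set.mem_union, Finset.mem_coe,
      Finset.mem_sdiff, T, U, mem_colorClass]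
    cases c x <;> cases c (x + 1) <;> cases b <;> simp
  rw [hCE, Set.ncard_coe_finset, Finset.card_union_of_disjoint disjoint_sdiff_sdiff,
    Finset.card_sdiff_comm hcard.symm, hstarts]
  have := Finset.card_sdiff_comm hcard
  omega

theorem lessCount_eq (c : ZMod n → Bool) :
    lessCount c = min (colorClass c true).card (colorClass c false).card := by
  simp [lessCount, ← Set.ncard_coe_finset, colorClass]

/-- Recoloring a smallest block of the majority color removes two cut edges and preserves
`(1 + 1/k)`-balancedness, as long as there are at least `2 * k` cut edges. -/
theorem exists_remove_two_cuts {k m : ℕ} (hk : 1 ≤ k) (hkm : k ≤ m)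
    (hm : (CE c).ncard = 2 * m)
    (hbal : ∀ b, k * n ≤ 2 * k * (colorClass c b).card + n) :
    ∃ c' : ZMod n → Bool, CE c' ⊆ CE c ∧ (CE c').ncard = 2 * (m - 1) ∧
      ∀ b, k * n ≤ 2 * k * (colorClass c' b).card + n := by
  obtain ⟨b, hb⟩ : ∃ b, (colorClass c !b).card ≤ (colorClass c b).card := by
    rcases le_total (colorClass c true).card (colorClass c false).card with h | h
    · exact ⟨false, h⟩
    · exact ⟨true, h⟩
  have hstarts : (blockStarts c b).card = m := by
    have := ncard_CE c b
    omega
  obtain ⟨s, hs, hsmall⟩ := exists_small_block (c := c) (b := b)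
    (Finset.card_pos.1 (by omega))
  rw [hstarts] at hsmall
  have hsum := card_colorClass_add_not c b
  have hsum' := card_colorClass_add_not (flipBlock c b s) b
  have hflip := card_colorClass_flipBlock (c := c) (b := b) (s := s)
  refine ⟨flipBlock c b s, CE_flipBlock_subset hs, ?_, fun d => ?_⟩
  · rw [ncard_CE _ b, blockStarts_flipBlock hs, Finset.card_erase_of_mem hs, hstarts]
  · rcases eq_or_ne d b with rfl | hd
    · have hkB := Nat.mul_le_mul_right (block c d s).card hkm
      zify at *
      nlinarith [mul_nonneg (sub_nonneg.2 hk) (sub_nonneg.2 hb)]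
    · obtain rfl : d = !b := by cases d <;> cases b <;> simp_all
      have hle : (colorClass c !b).card ≤ (colorClass (flipBlock c b s) !b).card := by omega
      exact (hbal !b).trans (Nat.add_le_add_right (Nat.mul_le_mul_left _ hle) n)

theorem exists_balanced_with_cuts {k : ℕ} (hk : 1 ≤ k) (d : ℕ) (c : ZMod n → Bool)
    (hm : (CE c).ncard = 2 * (k + d))
    (hbal : ∀ b, k * n ≤ 2 * k * (colorClass c b).card + n) :
    ∃ c' : ZMod n → Bool, CE c' ⊆ CE c ∧ (CE c').ncard = 2 * k ∧
      ∀ b, k * n ≤ 2 * k * (colorClass c' b).card + n := by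
  induction d generalizing c with
  | zero => exact ⟨c, subset_rfl, hm, hbal⟩
  | succ d ih =>
    obtain ⟨c₁, hsub₁, hcard₁, hbal₁⟩ := exists_remove_two_cuts hk (by omega) hm hbal
    obtain ⟨c₂, hsub₂, hcard₂, hbal₂⟩ := ih c₁ hcard₁ hbal₁
    exact ⟨c₂, hsub₂.trans hsub₁, hcard₂, hbal₂⟩

end Ring

theorem global_rebalancing (n k : ℕ) (hn : 0 < n) (hne : Even n) (hk : 1 ≤ k)
    (c : ZMod n → Bool) (hbal : {i : ZMod n | c i = true}.ncard = n / 2) :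
    ∃ c' : ZMod n → Bool,
      CE c' ⊆ CE c ∧
      (CE c').ncard = min (2 * k) (CE c).ncard ∧
      (k - 1) * n ≤ 2 * k * lessCount c' := by
  have : NeZero n := ⟨hn.ne'⟩
  have htrue : (colorClass c true).card = n / 2 := by
    simpa [← Set.ncard_coe_finset, colorClass] using hbal
  have hsum := card_colorClass_add_not c true
  have hhalf : ∀ b, 2 * (colorClass c b).card = n := by
    obtain ⟨r, rfl⟩ := hne
    rintro (_ | _)
    · simp only [Bool.not_true] at hsum
      omega
    · omega
  have hbal' : ∀ b, k * n ≤ 2 * k * (colorClass c b).card + n := fun b => by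
    rw [mul_comm 2 k, mul_assoc, hhalf b]
    omega
  have hless : ∀ c' : ZMod n → Bool, (∀ b, k * n ≤ 2 * k * (colorClass c' b).card + n) →
      (k - 1) * n ≤ 2 * k * lessCount c' := fun c' h => by
    rw [Nat.sub_mul, one_mul, tsub_le_iff_right, lessCount_eq]
    rcases min_choice (colorClass c' true).card (colorClass c' false).card with h' | h' <;>
      rw [h'] <;> exact h _
  have hCE := ncard_CE c true
  rcases le_total k (blockStarts c true).card with h | h
  · obtain ⟨d, hd⟩ := Nat.exists_eq_add_of_le h
    obtain ⟨c', hsub, hcard, hc'⟩ := exists_balanced_with_cuts hk d c (by rw [hCE, hd]) hbal'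
    exact ⟨c', hsub, by omega, hless c' hc'⟩
  · exact ⟨c, subset_rfl, by omega, hless c hbal'⟩
end

section
/- Let n be an even positive integer and j ≥ 2 an integer. Let c : ZMod n → Bool be a coloring with |CE(c)| = 2j and 2·j·less(c) ≥ (j − 1)·n. Then there exists a coloring c' : ZMod n → Bool with CE(c') ⊆ CE(c), |CE(c')| = 2j − 2, and 2·(j − 1)·less(c') ≥ (j − 2)·n. -/
open Finset in
/-- Going around the ring, color `b` is entered as often as it is left. -/
theorem card_enter_eq_card_leave {n : ℕ} [NeZero n] (c : ZMod n → Bool) (b : Bool) :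
    #{i | c i ≠ b ∧ c (i + 1) = b} = #{i | c i = b ∧ c (i + 1) ≠ b} := by
  have hshift : #{i | c (i + 1) = b} = #{i | c i = b} :=
    card_equiv (Equiv.addRight 1) (by simp)
  have h₁ := card_filter_add_card_filter_not (s := {i | c (i + 1) = b}) (fun i => c i = b)
  have h₂ := card_filter_add_card_filter_not (s := {i | c i = b}) (fun i => c (i + 1) = b)
  simp only [filter_filter] at h₁ h₂
  simp only [and_comm (a := c (_ + 1) = b)] at h₁
  simp only [ne_eq]
  omega

open Finset in
theorem ncard_CE_eq {n : ℕ} [NeZero n] (c : ZMod n → Bool) (b : Bool) :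
    (CE c).ncard = 2 * #{i | c i ≠ b ∧ c (i + 1) = b} := by
  have hCE : CE c = ((({i | c i ≠ b ∧ c (i + 1) = b} : Finset (ZMod n)) ∪
      ({i | c i = b ∧ c (i + 1) ≠ b} : Finset (ZMod n)) : Finset (ZMod n)) : Set (ZMod n)) := by
    ext i
    simp only [CE, Set.mem_ofPred_eq, coe_union, coe_filter, mem_univ, true_and, Set.mem_union]
    cases c i <;> cases c (i + 1) <;> cases b <;> simp
  rw [hCE, Set.ncard_coe_finset, card_union_of_disjoint, ← card_enter_eq_card_leave]
  · omega
  · exact disjoint_filter.2 fun i _ h h' => h.1 h'.1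

open Finset in
theorem lessCount_eq_s2 {n : ℕ} [NeZero n] (c : ZMod n → Bool) (b : Bool) :
    lessCount c = min #{i | c i = b} #{i | c i = !b} := by
  have h (a : Bool) : {i : ZMod n | c i = a}.ncard = #{i | c i = a} := by
    rw [← Set.ncard_coe_finset]; simp
  rw [lessCount, h, h]
  cases b
  · exact min_comm _ _
  · rfl

open Finset in
theorem card_color_add_card_color_not {n : ℕ} [NeZero n] (c : ZMod n → Bool) (b : Bool) :
    #{i | c i = b} + #{i | c i = !b} = n := by
  have h := card_filter_add_card_filter_not (s := (univ : Finset (ZMod n))) (fun i => c i = b)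
  simpa [ZMod.card, Bool.eq_not] using h

/-- If color `b` is not the only one, each node of color `b` can be labelled by the first node
of its arc. -/
theorem exists_arcStart {n : ℕ} [NeZero n] (c : ZMod n → Bool) (b : Bool) (h : ∃ x, c x ≠ b) :
    ∃ start : ZMod n → ZMod n, ∀ i, c (i + 1) = b →
      start (i + 1) = if c i = b then start i else i + 1 := by
  have hex (i : ZMod n) : ∃ k : ℕ, c (i - k) ≠ b := by
    obtain ⟨x, hx⟩ := h
    exact ⟨(i - x).val, by simpa using hx⟩
  refine ⟨fun i => i - (Nat.find (hex i) : ℕ) + 1, fun i hi => ?_⟩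
  have hfind : Nat.find (hex (i + 1)) = Nat.find (hex i) + 1 := by
    have hex' : ∃ k : ℕ, c (i + 1 - (k + 1 : ℕ)) ≠ b := by
      simpa [add_sub_add_right_eq_sub] using hex i
    rw [Nat.find_comp_succ (hex (i + 1)) hex' (by simpa using hi)]
    simp [add_sub_add_right_eq_sub]
  split_ifs with hb
  · simp only [hfind]; push_cast; ring
  · have h0 : Nat.find (hex i) = 0 := by simpa using hb
    simp only [hfind, h0]; push_cast; ring

open Finset in
/-- Recoloring a smallest arc of color `b`. -/
theorem exists_recolor_smallest_arc {n j : ℕ} [NeZero n] (hj : 0 < j) (c : ZMod n → Bool)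
    (b : Bool) (hcut : (CE c).ncard = 2 * j) :
    ∃ (c' : ZMod n → Bool) (a : ℕ), CE c' ⊆ CE c ∧ (CE c').ncard = 2 * j - 2 ∧
      #{i | c' i = b} + a = #{i | c i = b} ∧ j * a ≤ #{i | c i = b} := by
  have hcard : #{i | c i ≠ b ∧ c (i + 1) = b} = j := by
    have := ncard_CE_eq c b
    omega
  set E : Finset (ZMod n) := {i | c i ≠ b ∧ c (i + 1) = b} with hE
  have hne : E.Nonempty := card_pos.1 (hcard ▸ hj)
  obtain ⟨start, hstart⟩ : ∃ start : ZMod n → ZMod n, ∀ i, c (i + 1) = b →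
      start (i + 1) = if c i = b then start i else i + 1 :=
    exists_arcStart c b (hne.imp fun x hx => (mem_filter.1 hx).2.1)
  let arc (e : ZMod n) : Finset (ZMod n) := {i | c i = b ∧ start i = e + 1}
  obtain ⟨e, he, hmin⟩ := exists_min_image E (fun e => #(arc e)) hne
  have hsmall : j * #(arc e) ≤ #{i | c i = b} := calc
    j * #(arc e) = #E • #(arc e) := by rw [hcard, smul_eq_mul]
    _ ≤ ∑ x ∈ E, #(arc x) := card_nsmul_le_sum _ _ _ hmin
    _ = #(E.biUnion arc) := by
      refine (card_biUnion fun x _ y _ hxy => disjoint_filter.2 fun i _ h h' => hxy ?_).symm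
      exact add_right_cancel (h.2.symm.trans h'.2)
    _ ≤ #{i | c i = b} := card_le_card <| biUnion_subset.2 fun x _ i hi =>
      mem_filter.2 ⟨mem_univ _, (mem_filter.1 hi).2.1⟩
  let c' (i : ZMod n) : Bool := if c i = b ∧ start i = e + 1 then !b else c i
  have hc' (i : ZMod n) : c' i = b ↔ c i = b ∧ start i ≠ e + 1 := by
    by_cases h : c i = b ∧ start i = e + 1
    · simp [c', h]
    · simp only [c', if_neg h]; tauto
  refine ⟨c', #(arc e), fun i hi => ?_, ?_, ?_, hsmall⟩
  · contrapose! hi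
    have hi' : c i = c (i + 1) := by simpa [CE] using hi
    have hs := hstart i
    rw [← hi'] at hs
    simp only [CE, Set.mem_ofPred_eq, not_not, c', ← hi']
    by_cases hb : c i = b <;> simp [hb, hs]
  · have herase : ({i | c' i ≠ b ∧ c' (i + 1) = b} : Finset (ZMod n)) = E.erase e := by
      ext i
      simp only [hE, mem_filter, mem_univ, true_and, mem_erase, ne_eq, hc']
      have hs := hstart i
      by_cases hb : c i = b <;> by_cases hb' : c (i + 1) = b <;> simp_all
    rw [ncard_CE_eq c' b, herase, card_erase_of_mem he, hcard]
    omega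
  · have h := card_filter_add_card_filter_not (s := {i | c i = b}) (fun i => start i = e + 1)
    simp only [filter_filter] at h
    simp only [hc', arc, ne_eq]
    omega

theorem rebalancing_step (n j : ℕ) (hn : 0 < n) (hne : Even n) (hj : 2 ≤ j)
    (c : ZMod n → Bool) (hcut : (CE c).ncard = 2 * j)
    (hbal : (j - 1) * n ≤ 2 * j * lessCount c) :
    ∃ c' : ZMod n → Bool,
      CE c' ⊆ CE c ∧
      (CE c').ncard = 2 * j - 2 ∧
      (j - 2) * n ≤ 2 * (j - 1) * lessCount c' := by
  have : NeZero n := ⟨hn.ne'⟩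
  obtain ⟨b, hb⟩ : ∃ b, Finset.card {i | c i = !b} ≤ Finset.card {i | c i = b} :=
    (le_total (Finset.card {i | c i = false}) (Finset.card {i | c i = true})).elim
      (⟨true, ·⟩) (⟨false, ·⟩)
  obtain ⟨c', a, hsub, hcard, hrec, hsmall⟩ :=
    exists_recolor_smallest_arc (by omega : 0 < j) c b hcut
  refine ⟨c', hsub, hcard, ?_⟩
  have hsum := card_color_add_card_color_not c b
  have hsum' := card_color_add_card_color_not c' b
  rw [lessCount_eq_s2 c b, min_eq_right hb] at hbal
  rw [lessCount_eq_s2 c' b]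
  generalize Finset.card {i | c i = b} = M at *
  generalize Finset.card {i | c i = !b} = L at *
  generalize Finset.card {i | c' i = b} = M' at *
  generalize Finset.card {i | c' i = !b} = L' at *
  obtain ⟨k, rfl⟩ := Nat.exists_eq_add_of_le' hj
  have hk₁ : k + 2 - 1 = k + 1 := rfl
  have hk₂ : k + 2 - 2 = k := rfl
  rw [hk₁] at hbal ⊢
  rw [hk₂]
  have hL : L ≤ L' := by omega
  have hM : (k + 1) * M ≤ (k + 2) * M' := by nlinarith
  refine le_of_mul_le_mul_left (a := k + 2) ?_ (by omega)
  rcases min_choice M' L' with h | h <;> rw [h]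
  · have h₁ := Nat.mul_le_mul_left (2 * (k + 1)) hM
    have h₂ : (k + 1) * (k + 1) * n ≤ (k + 1) * (k + 1) * (2 * M) :=
      Nat.mul_le_mul_left _ (by omega)
    nlinarith
  · have h₁ := Nat.mul_le_mul_left (k + 1) hbal
    have h₂ := Nat.mul_le_mul_left (2 * (k + 1) * (k + 2)) hL
    nlinarith
end

section
/- Let n be a positive integer, let c : ZMod n → Bool be a coloring with |CE(c)| = 2j for some integer j ≥ 1, and let r := |{i : ZMod n | c i = true}|. Then there exist a, b ∈ CE(c) with a ≠ b such that every node in the clockwise arc A := {a + t : t ∈ {1, …, (b − a).val}} is colored true, and j · (b − a).val ≤ r. -/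
/-- A true run starting at a rising edge `a` ends at a cut-edge `a + t`. -/
theorem exists_true_run {n : ℕ} [NeZero n] (c : ZMod n → Bool) {a : ZMod n}
    (h0 : c a = false) (h1 : c (a + 1) = true) :
    ∃ t : ℕ, 1 ≤ t ∧ t < n ∧ c (a + t + 1) = false ∧
      ∀ s ∈ Finset.Icc 1 t, c (a + (s : ZMod n)) = true := by
  have hn : 0 < n := Nat.pos_of_neZero n
  have hlast : c (a + ((n - 1 : ℕ) : ZMod n) + 1) = false := by
    simpa [Nat.cast_sub (show 1 ≤ n from hn)] using h0
  have hex : ∃ t : ℕ, c (a + t + 1) = false := ⟨n - 1, hlast⟩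
  refine ⟨Nat.find hex, ?_, ?_, Nat.find_spec hex, ?_⟩
  · rw [Nat.succ_le_iff, Nat.find_pos]
    simp [h1]
  · have := Nat.find_min' hex hlast
    omega
  · intro s hs
    rw [Finset.mem_Icc] at hs
    have hmin := Nat.find_min hex (show s - 1 < Nat.find hex by omega)
    simpa [Nat.cast_sub hs.1, add_assoc] using hmin

/-- Going around the ring, a coloring rises exactly as often as it falls. -/
theorem card_rising_eq_card_falling {n : ℕ} [NeZero n] (c : ZMod n → Bool) :
    (Finset.univ.filter fun i => c i = false ∧ c (i + 1) = true).card =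
      (Finset.univ.filter fun i => c i = true ∧ c (i + 1) = false).card := by
  have hshift : ∑ i, (if c (i + 1) = true then (1 : ℤ) else 0) =
      ∑ i, (if c i = true then (1 : ℤ) else 0) :=
    Equiv.sum_comp (Equiv.addRight (1 : ZMod n)) fun i => if c i = true then (1 : ℤ) else 0
  have hdiff : ∑ i, ((if c i = false ∧ c (i + 1) = true then (1 : ℤ) else 0) -
      (if c i = true ∧ c (i + 1) = false then 1 else 0)) =
      ∑ i, ((if c (i + 1) = true then (1 : ℤ) else 0) - (if c i = true then 1 else 0)) := by
    refine Finset.sum_congr rfl fun i _ => ?_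
    cases c i <;> cases c (i + 1) <;> simp
  rw [Finset.sum_sub_distrib, Finset.sum_sub_distrib, hshift, sub_self, Finset.sum_boole,
    Finset.sum_boole, sub_eq_zero] at hdiff
  exact_mod_cast hdiff

/-- Half of the cut-edges are rising edges. -/
theorem ncard_CE_s3 {n : ℕ} [NeZero n] (c : ZMod n → Bool) :
    (CE c).ncard = 2 * (Finset.univ.filter fun i => c i = false ∧ c (i + 1) = true).card := by
  have hCE : CE c = ↑((Finset.univ.filter fun i => c i = false ∧ c (i + 1) = true) ∪
      Finset.univ.filter fun i => c i = true ∧ c (i + 1) = false) := by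
    ext i
    simp only [CE, Set.mem_ofPred_eq, Finset.coe_union, Finset.coe_filter, Finset.mem_univ,
      true_and, Set.mem_union]
    cases c i <;> cases c (i + 1) <;> simp
  rw [hCE, Set.ncard_coe_finset, Finset.card_union_of_disjoint,
    ← card_rising_eq_card_falling, two_mul]
  rw [Finset.disjoint_filter]
  rintro i - ⟨h, -⟩ ⟨h', -⟩
  simp [h] at h'

/-- True runs starting at distinct false nodes are disjoint, so their lengths add up to at most
the number of true nodes. -/
theorem sum_true_run_le {n : ℕ} [NeZero n] (c : ZMod n → Bool) (S : Finset (ZMod n))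
    (L : ZMod n → ℕ) (hS : ∀ a ∈ S, c a = false)
    (hL : ∀ a ∈ S, ∀ s ∈ Finset.Icc 1 (L a), c (a + (s : ZMod n)) = true) :
    ∑ a ∈ S, L a ≤ {i : ZMod n | c i = true}.ncard := by
  have hle : ∀ a ∈ S, ∀ a' ∈ S, ∀ s s' : ℕ, s' ≤ L a' →
      a + (s : ZMod n) = a' + s' → s' ≤ s := by
    intro a ha a' ha' s s' hs' h
    by_contra! hlt
    have hrun := hL a' ha' (s' - s) (Finset.mem_Icc.2 ⟨by omega, by omega⟩)
    rw [Nat.cast_sub hlt.le, ← add_sub_assoc, ← h, add_sub_cancel_right, hS a ha] at hrun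
    simp at hrun
  have hcard : (S.sigma fun a => Finset.Icc 1 (L a)).card ≤
      (Finset.univ.filter fun i => c i = true).card := by
    refine Finset.card_le_card_of_injOn (fun p => p.1 + (p.2 : ZMod n)) ?_ ?_
    · rintro ⟨a, s⟩ hp
      obtain ⟨ha, hs⟩ := Finset.mem_sigma.1 hp
      simpa using hL a ha s hs
    · rintro ⟨a, s⟩ hp ⟨a', s'⟩ hp' h
      obtain ⟨ha, hs⟩ := Finset.mem_sigma.1 hp
      obtain ⟨ha', hs'⟩ := Finset.mem_sigma.1 hp'
      rw [Finset.mem_Icc] at hs hs'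
      obtain rfl : s = s' := le_antisymm (hle a' ha' a ha s' s hs.2 h.symm)
        (hle a ha a' ha' s s' hs'.2 h)
      obtain rfl : a = a' := add_right_cancel h
      rfl
  simpa [Finset.card_sigma, Set.ncard_eq_toFinset_card'] using hcard

theorem exists_small_true_arc (n : ℕ) (hn : 0 < n) (j : ℕ) (hj : 1 ≤ j)
    (c : ZMod n → Bool) (hcut : (CE c).ncard = 2 * j) :
    ∃ a ∈ CE c, ∃ b ∈ CE c, a ≠ b ∧
      (∀ t ∈ Finset.Icc 1 (b - a).val, c (a + (t : ZMod n)) = true) ∧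
      j * (b - a).val ≤ {i : ZMod n | c i = true}.ncard := by
  have : NeZero n := ⟨hn.ne'⟩
  set S := Finset.univ.filter fun i => c i = false ∧ c (i + 1) = true
  have hS : ∀ a ∈ S, c a = false ∧ c (a + 1) = true := fun a ha => (Finset.mem_filter.1 ha).2
  have hSj : S.card = j := by
    have : 2 * S.card = 2 * j := (ncard_CE_s3 c).symm.trans hcut
    omega
  have hrun : ∀ a, ∃ t : ℕ, a ∈ S → 1 ≤ t ∧ t < n ∧ c (a + t + 1) = false ∧
      ∀ s ∈ Finset.Icc 1 t, c (a + (s : ZMod n)) = true := by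
    intro a
    by_cases ha : a ∈ S
    · obtain ⟨t, ht⟩ := exists_true_run c (hS a ha).1 (hS a ha).2
      exact ⟨t, fun _ => ht⟩
    · exact ⟨0, fun h => absurd h ha⟩
  choose L hL using hrun
  have hsum := sum_true_run_le c S L (fun a ha => (hS a ha).1) fun a ha => (hL a ha).2.2.2
  obtain ⟨a, ha, hmin⟩ := S.exists_min_image L (Finset.card_pos.1 (by omega))
  obtain ⟨h1, hlt, hend, htrue⟩ := hL a ha
  have hb : c (a + (L a : ZMod n)) = true := htrue _ (Finset.mem_Icc.2 ⟨h1, le_rfl⟩)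
  have hval : (a + (L a : ZMod n) - a).val = L a := by
    rw [add_sub_cancel_left, ZMod.val_natCast_of_lt hlt]
  refine ⟨a, by simp [CE, hS a ha], a + (L a : ZMod n), by simp [CE, hb, hend], ?_, ?_, ?_⟩
  · intro h
    rw [← h, (hS a ha).1] at hb
    simp at hb
  · rwa [hval]
  · rw [hval, ← hSj, ← smul_eq_mul]
    exact (S.card_nsmul_le_sum L (L a) hmin).trans hsum
end

section
/- Let n be a positive integer and let C be a finite subset of ZMod n of even cardinality. Then there exists a coloring c : ZMod n → Bool with CE(c) = C. -/
/-- The number of elements of `C` whose representative in `[0, n)` is less than `k`. -/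
def countBelow {n : ℕ} (C : Finset (ZMod n)) (k : ℕ) : ℕ := (C.filter fun j => j.val < k).card

theorem countBelow_val_succ {n : ℕ} [NeZero n] (C : Finset (ZMod n)) (i : ZMod n) :
    countBelow C (i.val + 1) = countBelow C i.val + if i ∈ C then 1 else 0 := by
  have hval : ∀ j : ZMod n, j.val < i.val + 1 ↔ j.val < i.val ∨ j = i := fun j => by
    rw [Nat.lt_succ_iff_lt_or_eq, (ZMod.val_injective n).eq_iff]
  have hdisj : Disjoint (C.filter fun j => j.val < i.val) (C.filter fun j => j = i) :=
    Finset.disjoint_filter.2 fun j _ hlt heq => (heq ▸ hlt).false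
  simp only [countBelow, hval]
  rw [Finset.filter_or, Finset.card_union_of_disjoint hdisj, Finset.filter_eq']
  split_ifs <;> simp

theorem odd_countBelow_val_add_one {n : ℕ} [NeZero n] {C : Finset (ZMod n)}
    (hC : Even C.card) (i : ZMod n) :
    Odd (countBelow C (i + 1).val) ↔ Odd (countBelow C (i.val + 1)) := by
  have hi : (i + 1).val = (i.val + 1) % n := by
    rw [← ZMod.val_natCast, Nat.cast_add, ZMod.natCast_zmod_val, Nat.cast_one]
  rcases (Nat.succ_le_of_lt i.val_lt).lt_or_eq with h | h
  · rw [hi, Nat.mod_eq_of_lt h]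
  · have hn : i.val + 1 = n := h
    have hfull : countBelow C n = C.card := by
      simp [countBelow, Finset.filter_true_of_mem, ZMod.val_lt]
    rw [hi, hn, Nat.mod_self, hfull]
    simpa [countBelow] using hC

theorem exists_coloring_of_even_cutset (n : ℕ) (hn : 0 < n)
    (C : Finset (ZMod n)) (hC : Even C.card) :
    ∃ c : ZMod n → Bool, CE c = ↑C := by
  have : NeZero n := ⟨hn.ne'⟩
  refine ⟨fun i => decide (Odd (countBelow C i.val)), Set.ext fun i => ?_⟩
  simp only [CE, Set.mem_ofPred_eq, ne_eq, decide_eq_decide, Finset.mem_coe,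
    odd_countBelow_val_add_one hC, countBelow_val_succ]
  by_cases h : i ∈ C <;> simp [h, Nat.odd_add_one, -Nat.not_odd_iff_even]
end

section
/- Let n be a positive integer and let c₁, c₂ : ZMod n → Bool be colorings with CE(c₁) = CE(c₂). Then either c₁ = c₂, or c₁ i = !(c₂ i) for every i : ZMod n. -/
/-- A function on `ZMod n` invariant under the shift by one is constant. -/
theorem ZMod.eq_apply_zero_of_forall_apply_add_one {n : ℕ} {α : Type*} {f : ZMod n → α}
    (hf : ∀ i, f (i + 1) = f i) (i : ZMod n) : f i = f 0 := by
  obtain ⟨k, rfl⟩ := ZMod.intCast_surjective i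
  induction k using Int.induction_on with
  | zero => simp
  | succ k ih => rw [← ih, Int.cast_add, Int.cast_one, hf]
  | pred k ih => rw [← ih, ← hf, Int.cast_sub, Int.cast_one, sub_add_cancel]

theorem coloring_unique_up_to_swap (n : ℕ) (hn : 0 < n)
    (c₁ c₂ : ZMod n → Bool) (h : CE c₁ = CE c₂) :
    c₁ = c₂ ∨ ∀ i : ZMod n, c₁ i = !(c₂ i) := by
  have hshift (i : ZMod n) : (c₁ (i + 1) ^^ c₂ (i + 1)) = (c₁ i ^^ c₂ i) := by
    have hi : c₁ i ≠ c₁ (i + 1) ↔ c₂ i ≠ c₂ (i + 1) := Set.ext_iff.mp h i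
    revert hi
    generalize c₁ i = a, c₁ (i + 1) = b, c₂ i = c, c₂ (i + 1) = d
    revert a b c d
    decide
  have hconst := ZMod.eq_apply_zero_of_forall_apply_add_one (f := fun i => c₁ i ^^ c₂ i) hshift
  cases h0 : (c₁ 0 ^^ c₂ 0) with
  | false => exact Or.inl (funext fun i => by simpa [h0] using hconst i)
  | true => exact Or.inr fun i => by simpa [h0, Bool.eq_not] using hconst i
end

section
/- Let n be a positive integer, let c : ZMod n → Bool be a coloring, and let a, b : ZMod n with a ≠ b. Let A := {a + t : t ∈ {1, …, (b − a).val}} be the clockwise arc of nodes strictly after edge a up to and including node b, and define the coloring c' by c' i := !(c i) if i ∈ A and c' i := c i otherwise. Then CE(c') = CE(c) Δ {a, b}, the symmetric difference of CE(c) with the two-element set {a, b}. -/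
/-- The clockwise arc of nodes strictly after edge `a` up to (and including) node `b`:
the nodes `a + t` for `t ∈ {1, …, (b − a).val}`. -/
def arc {n : ℕ} (a b : ZMod n) : Finset (ZMod n) :=
  (Finset.Icc 1 (b - a).val).image (fun t : ℕ => a + (t : ZMod n))

theorem mem_arc_iff {n : ℕ} [NeZero n] (a b i : ZMod n) :
    i ∈ arc a b ↔ 1 ≤ (i - a).val ∧ (i - a).val ≤ (b - a).val := by
  simp only [arc, Finset.mem_image, Finset.mem_Icc]
  constructor
  · rintro ⟨t, ht, rfl⟩
    rwa [add_sub_cancel_left, ZMod.val_natCast_of_lt (ht.2.trans_lt (ZMod.val_lt _))]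
  · intro h
    exact ⟨(i - a).val, h, by rw [ZMod.natCast_zmod_val, add_sub_cancel]⟩

/-- Exactly the edges `a` and `b` join a node of the arc to a node outside it. -/
theorem mem_arc_iff_add_one_notMem_arc {n : ℕ} [NeZero n] {a b : ZMod n} (hab : a ≠ b)
    (i : ZMod n) : (i ∈ arc a b ↔ i + 1 ∉ arc a b) ↔ i = a ∨ i = b := by
  have ha : i = a ↔ (i - a).val = 0 := by rw [ZMod.val_eq_zero, sub_eq_zero]
  have hb : i = b ↔ (i - a).val = (b - a).val := by
    rw [(ZMod.val_injective n).eq_iff, sub_left_inj]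
  have hd : (b - a).val ≠ 0 := by rw [Ne, ZMod.val_eq_zero, sub_eq_zero]; exact hab.symm
  have hdn := ZMod.val_lt (b - a)
  have hkn := ZMod.val_lt (i - a)
  have hs : (i + 1 - a).val = if (i - a).val + 1 = n then 0 else (i - a).val + 1 := by
    rw [add_sub_right_comm, ZMod.val_add, ZMod.val_one_eq_one_mod, Nat.add_mod_mod]
    split_ifs with h
    · rw [h, Nat.mod_self]
    · exact Nat.mod_eq_of_lt (by omega)
  rw [mem_arc_iff, mem_arc_iff, ha, hb, hs]
  split_ifs <;> omega

theorem flip_arc_cutEdges (n : ℕ) (hn : 0 < n) (c : ZMod n → Bool)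
    (a b : ZMod n) (hab : a ≠ b) :
    CE (fun i => if i ∈ arc a b then !(c i) else c i) = symmDiff (CE c) {a, b} := by
  have : NeZero n := ⟨hn.ne'⟩
  ext i
  simp only [CE, Set.mem_symmDiff, Set.mem_ofPred_eq, Set.mem_insert_iff, Set.mem_singleton_iff,
    ← mem_arc_iff_add_one_notMem_arc hab i]
  by_cases h : i ∈ arc a b <;> by_cases h' : i + 1 ∈ arc a b <;>
    cases c i <;> cases c (i + 1) <;> simp [h, h']
end

section
/- Let n be an even positive integer. Let cOpt : ZMod n → Bool be a coloring with exactly n/2 nodes colored true, and let cOff : ZMod n → Bool be an arbitrary coloring. Then less(cOff) + min(d_H(cOpt, cOff), n − d_H(cOpt, cOff)) ≥ n/2. -/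
theorem Set.ncard_le_ncard_add_ncard_of_subset_union {α : Type*} [Finite α] {s t u : Set α}
    (h : s ⊆ t ∪ u) : s.ncard ≤ t.ncard + u.ncard :=
  (Set.ncard_le_ncard h).trans (Set.ncard_union_le t u)

theorem less_plus_potential_ge_half (n : ℕ) (hn : 0 < n) (hne : Even n)
    (cOpt cOff : ZMod n → Bool)
    (hbal : {i : ZMod n | cOpt i = true}.ncard = n / 2) :
    n / 2 ≤ lessCount cOff +
      min (hamDist cOpt cOff) (n - hamDist cOpt cOff) := by
  have : NeZero n := ⟨hn.ne'⟩
  have hfalse (c : ZMod n → Bool) : {i | c i = false} = {i | c i = true}ᶜ := by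
    ext i; simp
  have hopt := Set.ncard_add_ncard_compl {i | cOpt i = true}
  have hdist := Set.ncard_add_ncard_compl {i | cOpt i ≠ cOff i}
  rw [← hfalse, Nat.card_zmod] at hopt
  rw [Nat.card_zmod] at hdist
  have htd : {i | cOpt i = true} ⊆ {i | cOff i = true} ∪ {i | cOpt i ≠ cOff i} := by
    intro i
    simp only [Set.mem_union, Set.mem_ofPred_eq]
    grind
  have hfd : {i | cOpt i = false} ⊆ {i | cOff i = false} ∪ {i | cOpt i ≠ cOff i} := by
    intro i
    simp only [Set.mem_union, Set.mem_ofPred_eq]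
    grind
  have htc : {i | cOpt i = true} ⊆ {i | cOff i = false} ∪ {i | cOpt i ≠ cOff i}ᶜ := by
    intro i
    simp only [Set.mem_union, Set.mem_compl_iff, Set.mem_ofPred_eq]
    grind
  have hfc : {i | cOpt i = false} ⊆ {i | cOff i = true} ∪ {i | cOpt i ≠ cOff i}ᶜ := by
    intro i
    simp only [Set.mem_union, Set.mem_compl_iff, Set.mem_ofPred_eq]
    grind
  have := Set.ncard_le_ncard_add_ncard_of_subset_union htd
  have := Set.ncard_le_ncard_add_ncard_of_subset_union hfd
  have := Set.ncard_le_ncard_add_ncard_of_subset_union htc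
  have := Set.ncard_le_ncard_add_ncard_of_subset_union hfc
  unfold lessCount hamDist
  omega
end

section
/- Let n be an even positive integer and k ≥ 1 an integer. Let T ≥ 0 and let d₀, d₁, …, d_T : ZMod n → Bool be colorings such that 2·k·less(d₀) ≥ (k − 1)·n and 4·k·less(d_T) < (k − 2)·n. Let cOpt : ZMod n → Bool be a coloring with exactly n/2 nodes colored true. Then 2·k·( Σ_{t=1}^{T} d_H(d_{t−1}, d_t) + min(d_H(cOpt, d_T), n − d_H(cOpt, d_T)) ) ≥ (k + 1)·n. -/
/-- Each color class of `c` is covered by the same class of `c'` and the disagreement set. -/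
theorem ncard_colorClass_le_add_hamDist {n : ℕ} [NeZero n] (c c' : ZMod n → Bool) (b : Bool) :
    {i : ZMod n | c i = b}.ncard ≤ {i : ZMod n | c' i = b}.ncard + hamDist c c' := by
  refine (Set.ncard_le_ncard (fun i hi => ?_)).trans (Set.ncard_union_le _ _)
  simp only [Set.mem_ofPred_eq, Set.mem_union] at hi ⊢
  grind

theorem ncard_true_add_ncard_false {n : ℕ} [NeZero n] (c : ZMod n → Bool) :
    {i : ZMod n | c i = true}.ncard + {i : ZMod n | c i = false}.ncard = n := by
  have h := Set.ncard_add_ncard_compl {i : ZMod n | c i = true}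
  simpa [Set.compl_ofPred, Nat.card_zmod] using h

/-- Recoloring every node turns disagreements into agreements. -/
theorem hamDist_not {n : ℕ} [NeZero n] (c c' : ZMod n → Bool) :
    hamDist (fun i => !c i) c' = n - hamDist c c' := by
  have h := ncard_true_add_ncard_false (fun i => c i != c' i)
  have h_ne : {i : ZMod n | (c i != c' i) = true} = {i | c i ≠ c' i} := by ext i; simp
  have h_eq : {i : ZMod n | (c i != c' i) = false} = {i | (!c i) ≠ c' i} := by ext i; simp
  rw [h_ne, h_eq] at h
  exact Nat.eq_sub_of_add_eq' h

theorem lessCount_not {n : ℕ} (c : ZMod n → Bool) :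
    lessCount (fun i => !c i) = lessCount c := by
  simp [lessCount, min_comm]

/-- `lessCount` is 1-Lipschitz with respect to the Hamming distance. -/
theorem lessCount_le_add_hamDist {n : ℕ} [NeZero n] (c c' : ZMod n → Bool) :
    lessCount c ≤ lessCount c' + hamDist c c' := by
  have h_true := ncard_colorClass_le_add_hamDist c c' true
  have h_false := ncard_colorClass_le_add_hamDist c c' false
  unfold lessCount
  omega

/-- `lessCount` drops along a sequence of colorings by at most the total recoloring cost. -/
theorem lessCount_le_add_sum_hamDist {n : ℕ} [NeZero n] (T : ℕ)
    (d : Fin (T + 1) → ZMod n → Bool) :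
    lessCount (d 0) ≤
      lessCount (d (Fin.last T)) + ∑ t : Fin T, hamDist (d t.castSucc) (d t.succ) := by
  induction T with
  | zero => simp
  | succ T ih =>
    have h_init := ih (fun t => d t.castSucc)
    have h_last := lessCount_le_add_hamDist (d (Fin.last T).castSucc) (d (Fin.last T).succ)
    rw [Fin.sum_univ_castSucc, ← Fin.succ_last]
    simp only [Fin.castSucc_zero, ← Fin.succ_castSucc] at h_init ⊢
    omega

theorem phase_cost_lower_bound (n k : ℕ) (hn : 0 < n) (hne : Even n) (hk : 1 ≤ k)
    (T : ℕ) (d : Fin (T + 1) → ZMod n → Bool)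
    (hstart : (k - 1) * n ≤ 2 * k * lessCount (d 0))
    (hend : 4 * k * lessCount (d (Fin.last T)) < (k - 2) * n)
    (cOpt : ZMod n → Bool)
    (hbal : {i : ZMod n | cOpt i = true}.ncard = n / 2) :
    (k + 1) * n ≤ 2 * k *
      (∑ t : Fin T, hamDist (d t.castSucc) (d t.succ) +
        min (hamDist cOpt (d (Fin.last T))) (n - hamDist cOpt (d (Fin.last T)))) := by
  have : NeZero n := ⟨hn.ne'⟩
  have h_path := lessCount_le_add_sum_hamDist T d
  have h_dist := lessCount_le_add_hamDist cOpt (d (Fin.last T))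
  have h_codist := lessCount_le_add_hamDist (fun i => !cOpt i) (d (Fin.last T))
  rw [lessCount_not, hamDist_not] at h_codist
  have h_opt : 2 * lessCount cOpt = n := by
    have h := ncard_true_add_ncard_false cOpt
    obtain ⟨m, rfl⟩ := hne
    unfold lessCount
    omega
  generalize hamDist cOpt (d (Fin.last T)) = x at *
  generalize ∑ t : Fin T, hamDist (d t.castSucc) (d t.succ) = S at *
  have h_total : 2 * lessCount (d 0) + n ≤
      2 * (S + min x (n - x)) + 4 * lessCount (d (Fin.last T)) := by omega
  have h_k : 2 < k := by
    by_contra! h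
    simp [Nat.sub_eq_zero_of_le h] at hend
  obtain ⟨j, rfl⟩ := Nat.exists_eq_add_of_lt h_k
  have h_scaled := Nat.mul_le_mul_left (2 + j + 1) h_total
  rw [show 2 + j + 1 - 1 = j + 2 by omega] at hstart
  rw [show 2 + j + 1 - 2 = j + 1 by omega] at hend
  nlinarith
end
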